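/- For every Segre collection S, the stabilizer subgroup {g ∈ Equiv.Perm (Fin 6) : {g σ g⁻¹ : σ ∈ S} = S} has cardinality 120 (a copy of S₅), and this subgroup acts transitively on Fin 6 (so it is a non-standard copy of S₅ in S₆, not the stabilizer of a point). -/

import Mathlib

/-- A matching of `Fin 6`: a fixed-point-free involution. -/
def IsMatching (σ : Equiv.Perm (Fin 6)) : Prop :=
  (∀ x, σ (σ x) = x) ∧ ∀ x, σ x ≠ x

/-- Two matchings are disjoint if they share no pair. -/
def DisjointMatchings (σ τ : Equiv.Perm (Fin 6)) : Prop :=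
  ∀ x, σ x ≠ τ x

/-- A Segre collection: a set of five pairwise disjoint matchings of `Fin 6`. -/
def IsSegreCollection (S : Finset (Equiv.Perm (Fin 6))) : Prop :=
  S.card = 5 ∧ (∀ σ ∈ S, IsMatching σ) ∧
    ∀ σ ∈ S, ∀ τ ∈ S, σ ≠ τ → DisjointMatchings σ τ

open Equiv in
/-- The three matchings of `Fin 6` containing the pair `{0, i+1}`. -/
def segM : Fin 5 → Fin 3 → Equiv.Perm (Fin 6) :=
  ![![swap 0 1 * swap 2 3 * swap 4 5, swap 0 1 * swap 2 4 * swap 3 5, swap 0 1 * swap 2 5 * swap 3 4],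
    ![swap 0 2 * swap 1 3 * swap 4 5, swap 0 2 * swap 1 4 * swap 3 5, swap 0 2 * swap 1 5 * swap 3 4],
    ![swap 0 3 * swap 1 2 * swap 4 5, swap 0 3 * swap 1 4 * swap 2 5, swap 0 3 * swap 1 5 * swap 2 4],
    ![swap 0 4 * swap 1 2 * swap 3 5, swap 0 4 * swap 1 3 * swap 2 5, swap 0 4 * swap 1 5 * swap 2 3],
    ![swap 0 5 * swap 1 2 * swap 3 4, swap 0 5 * swap 1 3 * swap 2 4, swap 0 5 * swap 1 4 * swap 2 3]]

/-- A standard Segre collection. -/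
def segS0 : Finset (Equiv.Perm (Fin 6)) :=
  {segM 0 0, segM 1 1, segM 2 2, segM 3 1, segM 4 0}

/-- Conjugation of a collection. -/
def segConj (g : Equiv.Perm (Fin 6)) (S : Finset (Equiv.Perm (Fin 6))) :
    Finset (Equiv.Perm (Fin 6)) := S.image (fun σ => g * σ * g⁻¹)

/-- The conjugation action on collections. -/
@[reducible] def segAction : MulAction (Equiv.Perm (Fin 6)) (Finset (Equiv.Perm (Fin 6))) where
  smul := segConj
  one_smul S := by
    change segConj 1 S = S
    simp [segConj]
  mul_smul g h S := by
    change segConj (g * h) S = segConj g (segConj h S)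
    simp [segConj, Finset.image_image, Function.comp_def, mul_assoc]

/-- The six Segre collections. -/
def segP (k : Fin 6) : Finset (Equiv.Perm (Fin 6)) := segConj (Equiv.swap 0 k) segS0

instance segDecDisjoint (σ τ : Equiv.Perm (Fin 6)) : Decidable (DisjointMatchings σ τ) := by
  unfold DisjointMatchings; infer_instance

instance segDecMatching (σ : Equiv.Perm (Fin 6)) : Decidable (IsMatching σ) := by
  unfold IsMatching; infer_instance

set_option maxRecDepth 100000 in
theorem segM_complete : ∀ σ : Equiv.Perm (Fin 6), IsMatching σ →
    ∀ i : Fin 5, σ 0 = i.succ → ∃ a, σ = segM i a := by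
  decide +kernel

theorem segP_injective : Function.Injective segP := by
  unfold Function.Injective
  decide +kernel

set_option synthInstance.maxHeartbeats 400000 in
set_option synthInstance.maxSize 4000 in
theorem segP_classify : ∀ a b : Fin 3, DisjointMatchings (segM 0 a) (segM 1 b) →
    ∀ c, DisjointMatchings (segM 0 a) (segM 2 c) → DisjointMatchings (segM 1 b) (segM 2 c) →
    ∀ d, DisjointMatchings (segM 0 a) (segM 3 d) → DisjointMatchings (segM 1 b) (segM 3 d) →
      DisjointMatchings (segM 2 c) (segM 3 d) →
    ∀ e, DisjointMatchings (segM 0 a) (segM 4 e) → DisjointMatchings (segM 1 b) (segM 4 e) →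
      DisjointMatchings (segM 2 c) (segM 4 e) → DisjointMatchings (segM 3 d) (segM 4 e) →
    ∃ k, ({segM 0 a, segM 1 b, segM 2 c, segM 3 d, segM 4 e} : Finset _) = segP k := by
  decide +kernel

theorem segM_injective : ∀ i j : Fin 5, i ≠ j → ∀ a b, segM i a ≠ segM j b := by
  decide +kernel

theorem segS0_trans : ∀ y : Fin 6,
    ∃ h ∈ ({1, segM 0 1, segM 1 0, segM 2 0, segM 3 0, segM 4 1} : Finset (Equiv.Perm (Fin 6))),
      segConj h segS0 = segS0 ∧ h 0 = y := by
  decide +kernel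

theorem seg_classify (S : Finset (Equiv.Perm (Fin 6))) (hS : IsSegreCollection S) :
    ∃ k, S = segP k := by
  obtain ⟨hc, hm, hd⟩ := hS
  have hinj : Set.InjOn (fun σ : Equiv.Perm (Fin 6) => σ 0) S := by
    intro σ hσ τ hτ h
    by_contra hne
    exact hd σ hσ τ hτ hne 0 h
  have himg : S.image (fun σ : Equiv.Perm (Fin 6) => σ 0) = Finset.univ.erase 0 := by
    apply Finset.eq_of_subset_of_card_le
    · intro x hx
      obtain ⟨σ, hσ, rfl⟩ := Finset.mem_image.1 hx
      simpa using (hm σ hσ).2 0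
    · rw [Finset.card_image_of_injOn hinj, hc]
      simp
  have hex : ∀ i : Fin 5, ∃ a, segM i a ∈ S := by
    intro i
    have : i.succ ∈ S.image (fun σ : Equiv.Perm (Fin 6) => σ 0) := by
      rw [himg]; simp
    obtain ⟨σ, hσ, h⟩ := Finset.mem_image.1 this
    obtain ⟨a, rfl⟩ := segM_complete σ (hm σ hσ) i h
    exact ⟨a, hσ⟩
  choose a ha using hex
  have hdis : ∀ i j, i ≠ j → DisjointMatchings (segM i (a i)) (segM j (a j)) := fun i j hij =>
    hd _ (ha i) _ (ha j) (segM_injective i j hij _ _)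
  obtain ⟨k, hk⟩ := segP_classify (a 0) (a 1) (hdis _ _ (by decide))
    (a 2) (hdis _ _ (by decide)) (hdis _ _ (by decide))
    (a 3) (hdis _ _ (by decide)) (hdis _ _ (by decide)) (hdis _ _ (by decide))
    (a 4) (hdis _ _ (by decide)) (hdis _ _ (by decide)) (hdis _ _ (by decide))
    (hdis _ _ (by decide))
  refine ⟨k, ?_⟩
  have h1 : Finset.univ.image (fun i => segM i (a i)) = S := by
    apply Finset.eq_of_subset_of_card_le
    · intro x hx
      obtain ⟨i, -, rfl⟩ := Finset.mem_image.1 hx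
      exact ha i
    · rw [Finset.card_image_of_injective, hc]
      · simp
      · intro i j h
        by_contra hij
        exact segM_injective i j hij _ _ h
  rw [← hk, ← h1]
  ext x
  simp [Fin.exists_fin_succ, eq_comm]

theorem segConj_segre (g : Equiv.Perm (Fin 6)) (S : Finset (Equiv.Perm (Fin 6)))
    (hS : IsSegreCollection S) : IsSegreCollection (segConj g S) := by
  obtain ⟨hc, hm, hd⟩ := hS
  refine ⟨?_, ?_, ?_⟩
  · rw [segConj, Finset.card_image_of_injective, hc]
    intro σ τ h
    simpa using h
  · intro σ hσ
    obtain ⟨τ, hτ, rfl⟩ := Finset.mem_image.1 hσ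
    refine ⟨fun x => ?_, fun x h => ?_⟩
    · simp [(hm τ hτ).1]
    · refine (hm τ hτ).2 (g⁻¹ x) ?_
      apply g.injective
      simpa using h
  · intro σ hσ τ hτ hne x h
    obtain ⟨σ', hs, rfl⟩ := Finset.mem_image.1 hσ
    obtain ⟨τ', ht, rfl⟩ := Finset.mem_image.1 hτ
    refine hd σ' hs τ' ht (fun h => hne (by rw [h])) (g⁻¹ x) ?_
    apply g.injective
    simpa using h

/-- The stabilizer of a Segre collection under the conjugation action of `S₆` is a copy
of `S₅` (it has 120 elements) which moreover acts transitively on `Fin 6`. -/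
theorem segre_collection_stabilizer (S : Finset (Equiv.Perm (Fin 6)))
    (hS : IsSegreCollection S) :
    Nat.card {g : Equiv.Perm (Fin 6) // S.image (fun σ => g * σ * g⁻¹) = S} = 120 ∧
      ∀ x y : Fin 6, ∃ g : Equiv.Perm (Fin 6),
        S.image (fun σ => g * σ * g⁻¹) = S ∧ g x = y := by
  have hmul : ∀ g h T, segConj (g * h) T = segConj g (segConj h T) := segAction.mul_smul
  have hone : ∀ T, segConj 1 T = T := segAction.one_smul
  have hinv : ∀ g T U, segConj g T = U → segConj g⁻¹ U = T := by
    rintro g T _ rfl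
    rw [← hmul, inv_mul_cancel, hone]
  obtain ⟨k, hk⟩ := seg_classify S hS
  constructor
  · have horb : @MulAction.orbit _ _ segAction.toSMul S = Set.range segP := by
      ext T
      constructor
      · rintro ⟨g, rfl⟩
        obtain ⟨j, hj⟩ := seg_classify _ (segConj_segre g S hS)
        exact ⟨j, hj.symm⟩
      · rintro ⟨j, rfl⟩
        refine ⟨Equiv.swap 0 j * (Equiv.swap 0 k)⁻¹, ?_⟩
        change segConj _ S = _
        rw [hmul, hinv _ segS0 S hk.symm]
        rfl
    have h2 := Nat.card_congr (@MulAction.orbitProdStabilizerEquivGroup _ _ _ segAction S)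
    rw [Nat.card_prod, horb, Nat.card_range_of_injective segP_injective] at h2
    have h3 : Nat.card (Equiv.Perm (Fin 6)) = 720 := by
      rw [Nat.card_eq_fintype_card, Fintype.card_perm]; rfl
    rw [h3, Nat.card_fin] at h2
    change Nat.card (@MulAction.stabilizer _ _ _ segAction S) = 120
    omega
  · intro x y
    obtain ⟨h, -, hh, hx⟩ := segS0_trans ((Equiv.swap 0 k)⁻¹ x)
    obtain ⟨h', -, hh', hy⟩ := segS0_trans ((Equiv.swap 0 k)⁻¹ y)
    refine ⟨Equiv.swap 0 k * (h' * (h⁻¹ * (Equiv.swap 0 k)⁻¹)), ?_, ?_⟩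
    · change segConj _ S = S
      rw [hmul, hmul, hmul, hinv _ segS0 S hk.symm, hinv _ _ _ hh, hh']
      exact hk.symm
    · have h1 : h⁻¹ ((Equiv.swap 0 k)⁻¹ x) = 0 := by
        rw [← hx]; simp
      rw [Equiv.Perm.mul_apply, Equiv.Perm.mul_apply, Equiv.Perm.mul_apply, h1, hy]
      simp
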